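/- arXiv:2307.11855 — 3 statements merged into one kernel-verified Lean document; each statement's English description precedes it below -/
import Mathlib

section
/- Lower bound for self-adjusting RLS: For every a ∈ ℤⁿ \ {0ⁿ} and all constants α with 1 < α ≤ 2 and β with 1/2 < β < 1, the expected optimization time of RLS_{α,β}, started with the all-0 integer string and all-1 velocity vector, on the fitness function f_a is Ω(n · log |a|₁). -/
open scoped ENNReal BigOperators

/-- The fitness `f_a(x) = ∑ i, |x i − a i|` (to be minimized). -/
def fitness {n : ℕ} (a x : Fin n → ℤ) : ℕ := ∑ i, (x i - a i).natAbs

/-- `|a|₁ = ∑ i, |a i|`. -/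
def normOne {n : ℕ} (a : Fin n → ℤ) : ℕ := ∑ i, (a i).natAbs

/-- `|a|_∞ = max_i |a i|`. -/
def normInf {n : ℕ} (a : Fin n → ℤ) : ℕ := Finset.univ.sup fun i => (a i).natAbs

/-- A state of `RLS_{α,β}`: a search point `x ∈ ℤⁿ` together with a velocity vector
`v ∈ ℝⁿ`. -/
abbrev RlsState (n : ℕ) := (Fin n → ℤ) × (Fin n → ℝ)

/-- The deterministic outcome of one iteration of `RLS_{α,β}` on `f_a` from state `s`,
given that position `i` was chosen and the direction is `+⌊v i⌋` if `b` and `−⌊v i⌋`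
otherwise: the offspring `y` agrees with `x = s.1` except at position `i`; if
`f_a(y) < f_a(x)` the velocity at `i` is multiplied by `α`, otherwise it is replaced by
`max 1 (β·v i)`; if `f_a(y) ≤ f_a(x)` the search point is replaced by `y`. -/
noncomputable def rlsUpdate {n : ℕ} (a : Fin n → ℤ) (α β : ℝ) (s : RlsState n)
    (i : Fin n) (b : Bool) : RlsState n :=
  let y : Fin n → ℤ := Function.update s.1 i (s.1 i + (if b then ⌊s.2 i⌋ else -⌊s.2 i⌋))
  ((if fitness a y ≤ fitness a s.1 then y else s.1),
    Function.update s.2 i (if fitness a y < fitness a s.1 then α * s.2 i else max 1 (β * s.2 i)))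

/-- One-step transition probability of `RLS_{α,β}` on `f_a`: a position `i` is chosen
uniformly at random and the direction is `±⌊v i⌋` with probability `1/2` each. -/
noncomputable def rlsTransP {n : ℕ} (a : Fin n → ℤ) (α β : ℝ) (s s' : RlsState n) : ℝ≥0∞ :=
  ∑ i : Fin n, ∑ b : Bool,
    (1 / (2 * (n : ℝ≥0∞))) * (if s' = rlsUpdate a α β s i b then 1 else 0)

/-- Distribution of the state of `RLS_{α,β}` after `t` iterations, started at the all-`0`
search point with all-`1` velocity vector. -/
noncomputable def rlsDist (n : ℕ) (a : Fin n → ℤ) (α β : ℝ) : ℕ → RlsState n → ℝ≥0∞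
  | 0 => fun s => if s = ((fun _ => 0), fun _ => 1) then 1 else 0
  | t + 1 => fun s' => ∑' s : RlsState n, rlsDist n a α β t s * rlsTransP a α β s s'

/-- Expected optimization time of `RLS_{α,β}` on `f_a` (started at the all-`0` string with
all-`1` velocities): since the optimum is absorbing,
`E[T] = ∑_{t ≥ 0} P(T > t) = ∑_{t ≥ 0} P(f_a(X_t) ≠ 0)`. -/
noncomputable def rlsExpTime (n : ℕ) (a : Fin n → ℤ) (α β : ℝ) : ℝ≥0∞ :=
  ∑' t : ℕ, ∑' s : RlsState n, if fitness a s.1 = 0 then 0 else rlsDist n a α β t s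

open Classical in
theorem rls_step {n : ℕ} (a : Fin n → ℤ) (α β : ℝ) (g : RlsState n → ℝ≥0∞) (s : RlsState n) :
    ∑' s', rlsTransP a α β s s' * g s'
      = ∑ i : Fin n, ∑ b : Bool, (1 / (2 * (n : ℝ≥0∞))) * g (rlsUpdate a α β s i b) := by
  unfold rlsTransP
  simp_rw [Finset.sum_mul]
  rw [Summable.tsum_finsetSum (fun _ _ => ENNReal.summable)]
  refine Finset.sum_congr rfl fun i _ => ?_
  rw [Summable.tsum_finsetSum (fun _ _ => ENNReal.summable)]
  refine Finset.sum_congr rfl fun b _ => ?_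
  rw [tsum_eq_single (rlsUpdate a α β s i b)]
  · simp
  · intro s' h
    simp [h]

theorem rls_drift_step {n : ℕ} (a : Fin n → ℤ) (α β : ℝ) (g : RlsState n → ℝ≥0∞)
    (h0 : ∀ s, fitness a s.1 = 0 → g s = 0)
    (hd : ∀ s, g s ≤ 1 + ∑ i : Fin n, ∑ b : Bool,
      (1 / (2 * (n : ℝ≥0∞))) * g (rlsUpdate a α β s i b)) (t : ℕ) :
    ∑' s, rlsDist n a α β t s * g s ≤
      (∑' s : RlsState n, if fitness a s.1 = 0 then 0 else rlsDist n a α β t s)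
      + ∑' s, rlsDist n a α β (t+1) s * g s := by
  have h1 : ∑' s, rlsDist n a α β (t+1) s * g s =
      ∑' s, rlsDist n a α β t s * ∑' s', rlsTransP a α β s s' * g s' := by
    simp only [rlsDist]
    simp_rw [← ENNReal.tsum_mul_right, ← ENNReal.tsum_mul_left]
    rw [ENNReal.tsum_comm]
    simp_rw [mul_assoc]
  rw [h1, ← ENNReal.tsum_add]
  refine ENNReal.tsum_le_tsum fun s => ?_
  split_ifs with h
  · simp [h0 s h]
  · rw [rls_step]
    calc _ ≤ rlsDist n a α β t s * (1 + _) := mul_le_mul_right (hd s) _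
      _ = _ := by rw [mul_add, mul_one]

theorem rls_drift {n : ℕ} (a : Fin n → ℤ) (α β : ℝ) (g : RlsState n → ℝ≥0∞) (B : ℝ≥0∞)
    (hB : B ≠ ⊤) (hgB : ∀ s, g s ≤ B)
    (h0 : ∀ s, fitness a s.1 = 0 → g s = 0)
    (hd : ∀ s, g s ≤ 1 + ∑ i : Fin n, ∑ b : Bool,
      (1 / (2 * (n : ℝ≥0∞))) * g (rlsUpdate a α β s i b)) :
    g ((fun _ => 0), fun _ => 1) ≤ rlsExpTime n a α β := by
  by_cases hE : rlsExpTime n a α β = ⊤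
  · rw [hE]; exact le_top
  have hlim := ENNReal.tendsto_atTop_zero_of_tsum_ne_top hE
  set P : ℕ → ℝ≥0∞ := fun t =>
    ∑' s : RlsState n, if fitness a s.1 = 0 then 0 else rlsDist n a α β t s with hP
  have key : ∀ t, g ((fun _ => 0), fun _ => 1) ≤
      ∑ u ∈ Finset.range t, P u + ∑' s, rlsDist n a α β t s * g s := by
    intro t
    induction t with
    | zero =>
      rw [tsum_eq_single ((fun _ => 0), fun _ => 1)]
      · simp [rlsDist]
      · intro s h
        simp [rlsDist, h]
    | succ t ih =>
      refine ih.trans ?_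
      rw [Finset.sum_range_succ, add_assoc]
      gcongr
      exact rls_drift_step a α β g h0 hd t
  have key2 : ∀ t, g ((fun _ => 0), fun _ => 1) ≤ rlsExpTime n a α β + B * P t := by
    intro t
    refine (key t).trans (add_le_add (ENNReal.sum_le_tsum _) ?_)
    rw [hP, ← ENNReal.tsum_mul_left]
    refine ENNReal.tsum_le_tsum fun s => ?_
    split_ifs with h
    · simp [h0 s h]
    · rw [mul_comm]
      exact mul_le_mul_left (hgB s) _
  have hl2 : Filter.Tendsto (fun t => rlsExpTime n a α β + B * P t) Filter.atTop
      (nhds (rlsExpTime n a α β + B * 0)) :=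
    Filter.Tendsto.const_add _ (ENNReal.Tendsto.const_mul hlim (Or.inr hB))
  have := ge_of_tendsto' hl2 key2
  simpa using this

theorem rls_drift_real {n : ℕ} (hn : 0 < n) (a : Fin n → ℤ) (α β : ℝ) (G : RlsState n → ℝ) (B : ℝ)
    (hG0 : ∀ s, 0 ≤ G s) (hGB : ∀ s, G s ≤ B)
    (h0 : ∀ s, fitness a s.1 = 0 → G s = 0)
    (hd : ∀ s, ∑ i : Fin n, ∑ b : Bool, (G s - G (rlsUpdate a α β s i b)) ≤ 2 * n) :
    ENNReal.ofReal (G ((fun _ => 0), fun _ => 1)) ≤ rlsExpTime n a α β := by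
  refine rls_drift a α β (fun s => ENNReal.ofReal (G s)) (ENNReal.ofReal B) ENNReal.ofReal_ne_top
    (fun s => ENNReal.ofReal_le_ofReal (hGB s)) (fun s h => by simp [h0 s h]) ?_
  intro s
  have hn' : (0:ℝ) < n := by exact_mod_cast hn
  have e : (1 / (2 * (n : ℝ≥0∞))) = ENNReal.ofReal (1 / (2 * n)) := by
    rw [ENNReal.ofReal_div_of_pos (by positivity), ENNReal.ofReal_mul (by norm_num)]
    simp
  have e2 : ∑ i : Fin n, ∑ b : Bool,
      (1 / (2 * (n : ℝ≥0∞))) * ENNReal.ofReal (G (rlsUpdate a α β s i b))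
      = ENNReal.ofReal (∑ i : Fin n, ∑ b : Bool, (1 / (2 * n)) * G (rlsUpdate a α β s i b)) := by
    rw [ENNReal.ofReal_sum_of_nonneg]
    · refine Finset.sum_congr rfl fun i _ => ?_
      rw [ENNReal.ofReal_sum_of_nonneg]
      · refine Finset.sum_congr rfl fun b _ => ?_
        rw [e, ENNReal.ofReal_mul (by positivity)]
      · intro b _
        exact mul_nonneg (by positivity) (hG0 _)
    · intro i _
      exact Finset.sum_nonneg fun b _ => mul_nonneg (by positivity) (hG0 _)
  have nn : 0 ≤ ∑ i : Fin n, ∑ b : Bool, (1 / (2 * n)) * G (rlsUpdate a α β s i b) :=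
    Finset.sum_nonneg fun i _ => Finset.sum_nonneg fun b _ => mul_nonneg (by positivity) (hG0 _)
  rw [e2, ← ENNReal.ofReal_one, ← ENNReal.ofReal_add zero_le_one nn]
  refine ENNReal.ofReal_le_ofReal ?_
  have h := hd s
  simp only [Finset.sum_sub_distrib, Finset.sum_const, Finset.card_univ, Fintype.card_fin,
    Fintype.card_bool, nsmul_eq_mul] at h
  simp only [← Finset.mul_sum]
  set S := ∑ i : Fin n, ∑ b : Bool, G (rlsUpdate a α β s i b)
  rw [← sub_nonneg]
  have : 1 + 1 / (2 * (n:ℝ)) * S - G s = (2 * n + S - n * (2 * G s)) / (2 * n) := by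
    field_simp
  rw [this]
  apply div_nonneg _ (by positivity)
  push_cast at h
  linarith

theorem rls_upd_ne {n : ℕ} (a : Fin n → ℤ) (α β : ℝ) (s : RlsState n) (i j : Fin n) (b : Bool)
    (h : j ≠ i) : (rlsUpdate a α β s i b).1 j = s.1 j ∧ (rlsUpdate a α β s i b).2 j = s.2 j := by
  unfold rlsUpdate
  constructor
  · dsimp only
    split_ifs <;> simp [h]
  · simp [h]

theorem fitness_update_le {n : ℕ} (a x : Fin n → ℤ) (i : Fin n) (z : ℤ)
    (h : fitness a (Function.update x i z) ≤ fitness a x) :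
    (z - a i).natAbs ≤ (x i - a i).natAbs := by
  unfold fitness at h
  rw [← Finset.add_sum_erase _ _ (Finset.mem_univ i),
    ← Finset.add_sum_erase (a := i) Finset.univ (fun i => (x i - a i).natAbs)
      (Finset.mem_univ i)] at h
  rw [Finset.sum_congr (s₂ := Finset.univ.erase i) (g := fun i => (x i - a i).natAbs) rfl] at h
  · simpa using h
  · intro j hj
    rw [Function.update_of_ne (Finset.ne_of_mem_erase hj)]

theorem rls_upd_good {n : ℕ} (a : Fin n → ℤ) (α β : ℝ) (s : RlsState n) (i : Fin n) (b : Bool)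
    (h : s.1 i = a i) : (rlsUpdate a α β s i b).1 i = a i := by
  unfold rlsUpdate
  dsimp only
  split_ifs with h1 h2 h2
  all_goals try exact h
  all_goals
    have := fitness_update_le _ _ _ _ (by assumption)
    simp only [h, sub_self, Int.natAbs_zero, Nat.le_zero, Int.natAbs_eq_zero] at this
    simp only [Function.update_self, h]
    linarith

def rlsBad {n : ℕ} (a x : Fin n → ℤ) : Finset (Fin n) := Finset.univ.filter fun i => x i ≠ a i

noncomputable def rlsHarm (m : ℕ) : ℝ := ∑ j ∈ Finset.range m, 1 / ((j : ℝ) + 1)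

theorem rlsHarm_mono : Monotone rlsHarm := by
  intro a b h
  unfold rlsHarm
  exact Finset.sum_le_sum_of_subset_of_nonneg (Finset.range_mono h) fun _ _ _ => by positivity

theorem rlsHarm_log (m : ℕ) : Real.log m ≤ rlsHarm m := by
  have h := log_add_one_le_harmonic m
  have e : ((harmonic m : ℚ) : ℝ) = rlsHarm m := by
    simp [harmonic, rlsHarm]
  rw [e] at h
  rcases Nat.eq_zero_or_pos m with rfl | hm
  · simp [rlsHarm]
  · refine le_trans (Real.log_le_log (by exact_mod_cast hm) ?_) h
    push_cast
    linarith

theorem rls_coupon {n : ℕ} (hn : 0 < n) (a : Fin n → ℤ) (α β : ℝ) :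
    ENNReal.ofReal (n * rlsHarm (rlsBad a (fun _ => 0)).card) ≤ rlsExpTime n a α β := by
  refine rls_drift_real hn a α β (fun s => n * rlsHarm (rlsBad a s.1).card) (n * rlsHarm n)
    ?_ ?_ ?_ ?_
  · intro s
    exact mul_nonneg (by positivity) (Finset.sum_nonneg fun _ _ => by positivity)
  · intro s
    refine mul_le_mul_of_nonneg_left (rlsHarm_mono ?_) (by positivity)
    simpa using Finset.card_le_univ (rlsBad a s.1)
  · intro s h
    have : rlsBad a s.1 = ∅ := by
      unfold fitness at h
      rw [Finset.sum_eq_zero_iff] at h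
      unfold rlsBad
      rw [Finset.filter_eq_empty_iff]
      intro i hi
      have := h i hi
      simp only [Int.natAbs_eq_zero] at this
      simp only [ne_eq, not_not]
      linarith
    simp [this, rlsHarm]
  · intro s
    set m := (rlsBad a s.1).card with hm
    have hb : ∀ i : Fin n, ∀ b : Bool,
        (n:ℝ) * rlsHarm m - n * rlsHarm (rlsBad a (rlsUpdate a α β s i b).1).card
          ≤ if i ∈ rlsBad a s.1 then (n:ℝ) / m else 0 := by
      intro i b
      split_ifs with h
      · have hsub : (rlsBad a s.1).erase i ⊆ rlsBad a (rlsUpdate a α β s i b).1 := by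
          intro j hj
          rw [Finset.mem_erase] at hj
          have h1 := (rls_upd_ne a α β s i j b hj.1).1
          have h2 := hj.2
          simp only [rlsBad, Finset.mem_filter, Finset.mem_univ, true_and] at h2 ⊢
          rw [h1]; exact h2
        have hc := Finset.card_le_card hsub
        rw [Finset.card_erase_of_mem h, ← hm] at hc
        have hpos : 0 < m := Finset.card_pos.mpr ⟨i, h⟩
        obtain ⟨k, hk⟩ : ∃ k, m = k + 1 := ⟨m - 1, by omega⟩
        have h3 := rlsHarm_mono hc
        rw [hk] at h3 ⊢
        simp only [Nat.add_sub_cancel] at h3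
        have h4 : rlsHarm (k+1) = rlsHarm k + 1 / ((k:ℝ)+1) := by
          simp [rlsHarm, Finset.sum_range_succ]
        rw [h4]
        push_cast
        rw [div_eq_mul_one_div (n:ℝ), ← mul_sub]
        exact mul_le_mul_of_nonneg_left (by linarith) (by positivity)
      · have hsub : rlsBad a s.1 ⊆ rlsBad a (rlsUpdate a α β s i b).1 := by
          intro j hj
          have hji : j ≠ i := fun e => h (e ▸ hj)
          have h1 := (rls_upd_ne a α β s i j b hji).1
          simp only [rlsBad, Finset.mem_filter, Finset.mem_univ, true_and] at hj ⊢
          rw [h1]; exact hj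
        have h3 := rlsHarm_mono (Finset.card_le_card hsub)
        rw [← mul_sub]
        exact mul_nonpos_of_nonneg_of_nonpos (by positivity) (by linarith)
    refine (Finset.sum_le_sum fun i _ => Finset.sum_le_sum fun b _ => hb i b).trans ?_
    simp only [Finset.sum_const, Finset.card_univ, Fintype.card_bool, nsmul_eq_mul]
    rw [← Finset.mul_sum, Finset.sum_ite_mem, Finset.univ_inter, Finset.sum_const, ← hm,
      nsmul_eq_mul]
    rcases Nat.eq_zero_or_pos m with h | h
    · simp [h]
    · have : (m:ℝ) ≠ 0 := by positivity
      push_cast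
      field_simp
      exact le_refl _

noncomputable def rlsW {n : ℕ} (i : Fin n) (s : RlsState n) : ℝ := |(s.1 i : ℝ)| + max |s.2 i| 1

theorem rlsW_one_le {n : ℕ} (i : Fin n) (s : RlsState n) : 1 ≤ rlsW i s := by
  unfold rlsW
  have := abs_nonneg (s.1 i : ℝ)
  have := le_max_right |s.2 i| 1
  linarith

theorem rlsW_upd {n : ℕ} (a : Fin n → ℤ) (α β : ℝ) (hα₁ : 1 < α) (hα₂ : α ≤ 2)
    (hβ₁ : 1 / 2 < β) (hβ₂ : β < 1) (s : RlsState n) (i : Fin n) (b : Bool) :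
    rlsW i (rlsUpdate a α β s i b) ≤ 4 * rlsW i s := by
  set M := max |s.2 i| 1 with hM
  have hM1 : 1 ≤ M := le_max_right _ _
  have hMv : |s.2 i| ≤ M := le_max_left _ _
  have hf : |((⌊s.2 i⌋ : ℤ) : ℝ)| ≤ 2 * M := by
    have h1 := Int.floor_le (s.2 i)
    have h2 := Int.lt_floor_add_one (s.2 i)
    rw [abs_le] at hMv ⊢
    constructor <;> linarith
  have hx0 := abs_nonneg (s.1 i : ℝ)
  have hx : |((rlsUpdate a α β s i b).1 i : ℝ)| ≤ |(s.1 i : ℝ)| + 2 * M := by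
    unfold rlsUpdate
    dsimp only
    split_ifs with h1 h2 h2
    · simp only [Function.update_self]
      push_cast
      exact (abs_add_le _ _).trans (by linarith)
    · linarith
    · simp only [Function.update_self]
      push_cast
      refine (abs_add_le _ _).trans ?_
      rw [abs_neg]
      linarith
    · linarith
  have hv : max |(rlsUpdate a α β s i b).2 i| 1 ≤ 2 * M := by
    apply max_le _ (by linarith)
    unfold rlsUpdate
    dsimp only
    rw [Function.update_self]
    split_ifs
    all_goals
      first
      | rw [abs_mul, abs_of_pos (by linarith : 0 < α)]
        exact mul_le_mul hα₂ hMv (abs_nonneg _) (by norm_num)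
      | rw [abs_of_pos (lt_of_lt_of_le one_pos (le_max_left _ _))]
        apply max_le (by linarith)
        have := le_abs_self (β * s.2 i)
        rw [abs_mul, abs_of_pos (by linarith : 0 < β)] at this
        nlinarith [abs_nonneg (s.2 i)]
  unfold rlsW
  rw [← hM]
  linarith

theorem rls_speed {n : ℕ} (hn : 0 < n) (a : Fin n → ℤ) (α β : ℝ) (hα₁ : 1 < α) (hα₂ : α ≤ 2)
    (hβ₁ : 1 / 2 < β) (hβ₂ : β < 1) (i : Fin n) (hi : a i ≠ 0) :
    ENNReal.ofReal (n * Real.log |(a i : ℝ)| / 2) ≤ rlsExpTime n a α β := by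
  have hA : 1 ≤ |(a i : ℝ)| := by exact_mod_cast Int.one_le_abs hi
  have hA0 := Real.log_nonneg hA
  have hlog4 : Real.log 4 ≤ 2 := by
    have : (4:ℝ) = 2 ^ 2 := by norm_num
    rw [this, Real.log_pow]
    have := Real.log_two_lt_d9
    push_cast
    linarith
  have hnn : (0:ℝ) ≤ n / 2 := by positivity
  have key := rls_drift_real hn a α β
    (fun s => n / 2 * max 0 (Real.log |(a i : ℝ)| - Real.log (rlsW i s)))
    (n / 2 * Real.log |(a i : ℝ)|) ?_ ?_ ?_ ?_
  · refine le_trans (ENNReal.ofReal_le_ofReal ?_) key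
    have hw : rlsW i ((fun _ => 0), fun _ => 1) = 1 := by simp [rlsW]
    simp only [hw, Real.log_one, sub_zero]
    rw [max_eq_right hA0]
    apply le_of_eq
    ring
  · intro s
    exact mul_nonneg hnn (le_max_left _ _)
  · intro s
    refine mul_le_mul_of_nonneg_left (max_le hA0 ?_) hnn
    have := Real.log_nonneg (rlsW_one_le i s)
    linarith
  · intro s h
    unfold fitness at h
    rw [Finset.sum_eq_zero_iff] at h
    have h1 := h i (Finset.mem_univ i)
    simp only [Int.natAbs_eq_zero] at h1
    have h2 : s.1 i = a i := by linarith
    have h3 : |(a i : ℝ)| ≤ rlsW i s := by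
      unfold rlsW
      rw [h2]
      have := le_max_right |s.2 i| 1
      linarith
    have h4 := Real.log_le_log (by linarith) h3
    rw [max_eq_left (by linarith), mul_zero]
  · intro s
    have hb : ∀ j : Fin n, ∀ b : Bool,
        (n / 2 * max 0 (Real.log |(a i : ℝ)| - Real.log (rlsW i s)) : ℝ)
          - n / 2 * max 0 (Real.log |(a i : ℝ)| - Real.log (rlsW i (rlsUpdate a α β s j b)))
          ≤ if j = i then (n:ℝ) else 0 := by
      intro j b
      split_ifs with h
      · subst h
        have h1 := rlsW_upd a α β hα₁ hα₂ hβ₁ hβ₂ s j b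
        have h2 := rlsW_one_le j (rlsUpdate a α β s j b)
        have h3 := rlsW_one_le j s
        have h4 := Real.log_le_log (by linarith) h1
        rw [Real.log_mul (by norm_num) (by linarith)] at h4
        rw [← mul_sub]
        have h5 : max 0 (Real.log |(a j : ℝ)| - Real.log (rlsW j s)) ≤ 2 +
            max 0 (Real.log |(a j : ℝ)| - Real.log (rlsW j (rlsUpdate a α β s j b))) := by
          have l1 := le_max_left 0
            (Real.log |(a j : ℝ)| - Real.log (rlsW j (rlsUpdate a α β s j b)))
          have l2 := le_max_right 0
            (Real.log |(a j : ℝ)| - Real.log (rlsW j (rlsUpdate a α β s j b)))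
          exact max_le (by linarith) (by linarith)
        calc _ ≤ (n / 2 : ℝ) * 2 := mul_le_mul_of_nonneg_left (by linarith) hnn
          _ = n := by ring
      · have h1 := rls_upd_ne a α β s j i b (Ne.symm h)
        have : rlsW i (rlsUpdate a α β s j b) = rlsW i s := by
          unfold rlsW
          rw [h1.1, h1.2]
        rw [this]
        simp
    refine (Finset.sum_le_sum fun j _ => Finset.sum_le_sum fun b _ => hb j b).trans ?_
    simp [← Finset.mul_sum]

theorem normOne_le {n : ℕ} (a : Fin n → ℤ) (i : Fin n)
    (hi : ∀ j, (a j).natAbs ≤ (a i).natAbs) :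
    normOne a ≤ (rlsBad a (fun _ => 0)).card * (a i).natAbs := by
  have : normOne a = ∑ j ∈ rlsBad a (fun _ => 0), (a j).natAbs := by
    unfold normOne
    symm
    apply Finset.sum_subset (Finset.subset_univ _)
    intro j _ hj
    simp only [rlsBad, Finset.mem_filter, Finset.mem_univ, true_and, ne_eq, not_not] at hj
    simp [← hj]
  rw [this, ← smul_eq_mul]
  exact Finset.sum_le_card_nsmul _ _ _ fun j _ => hi j

/-- **Lower bound for self-adjusting RLS.**
For all constants `α` with `1 < α ≤ 2` and `β` with `1/2 < β < 1` and every
`a ∈ ℤⁿ \ {0ⁿ}`, the expected optimization time of `RLS_{α,β}`, started with the all-`0`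
integer string and all-`1` velocity vector, on `f_a` is `Ω(n · log |a|₁)`. -/
theorem rls_lower_bound (α β : ℝ) (hα₁ : 1 < α) (hα₂ : α ≤ 2)
    (hβ₁ : 1 / 2 < β) (hβ₂ : β < 1) :
    ∃ c : ℝ, 0 < c ∧ ∀ (n : ℕ) (a : Fin n → ℤ), a ≠ 0 →
      ENNReal.ofReal (c * n * Real.log (normOne a)) ≤ rlsExpTime n a α β := by
  refine ⟨1 / 4, by norm_num, fun n a ha => ?_⟩
  obtain ⟨k, hk⟩ := Function.ne_iff.mp ha
  have hn : 0 < n := k.pos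
  have : Nonempty (Fin n) := ⟨k⟩
  obtain ⟨i, hi⟩ := Finite.exists_max (fun j => (a j).natAbs)
  have hk' : 0 < (a k).natAbs := Int.natAbs_pos.mpr hk
  have hi0 : 0 < (a i).natAbs := hk'.trans_le (hi k)
  have h1 := rls_coupon hn a α β
  have h2 := rls_speed hn a α β hα₁ hα₂ hβ₁ hβ₂ i (Int.natAbs_pos.mp hi0)
  have h3 := normOne_le a i hi
  have hpos : 0 < normOne a :=
    hk'.trans_le (Finset.single_le_sum (f := fun j => (a j).natAbs) (fun _ _ => Nat.zero_le _)
      (Finset.mem_univ k))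
  set m := (rlsBad a (fun _ => 0)).card
  have hm : 0 < m := Nat.pos_of_ne_zero fun h => by simp [h] at h3; omega
  have hA : (((a i).natAbs : ℕ) : ℝ) = |(a i : ℝ)| := by
    rw [Nat.cast_natAbs]; push_cast; rfl
  have h4 : Real.log (normOne a) ≤ Real.log m + Real.log |(a i : ℝ)| := by
    rw [← hA, ← Real.log_mul (by positivity) (by positivity)]
    exact Real.log_le_log (by exact_mod_cast hpos) (by exact_mod_cast h3)
  have h5 := rlsHarm_log m
  have hlm : 0 ≤ Real.log m := Real.log_natCast_nonneg m
  have hn0 : (0:ℝ) ≤ n := by positivity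
  rcases le_total (Real.log m) (Real.log |(a i : ℝ)|) with h | h
  · refine le_trans (ENNReal.ofReal_le_ofReal ?_) h2
    nlinarith [mul_le_mul_of_nonneg_left (h4.trans (add_le_add_left h _)) hn0]
  · refine le_trans (ENNReal.ofReal_le_ofReal ?_) h1
    nlinarith [mul_le_mul_of_nonneg_left (h4.trans (add_le_add_right h _)) hn0,
      mul_le_mul_of_nonneg_left h5 hn0, mul_nonneg hn0 hlm]
end

section
/- Upper bound for self-adjusting RLS: For every a ∈ ℤⁿ \ {0ⁿ} and constants α, β satisfying 1 < α ≤ 2, 1/2 < β ≤ 0.9, 2αβ − β − α > 0, α + β > 2 and α²β > 1, the expected optimization time of RLS_{α,β}, started with the all-0 integer string and all-1 velocity vector, on the fitness function f_a is O(n · log |a|₁). -/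
open scoped ENNReal BigOperators

/-- One-coordinate potential. -/
noncomputable def phi (m : ℕ) (c : ℝ) (d : ℕ) (v : ℝ) : ℝ :=
  if d = 0 then 0
  else if 2 * (d : ℝ) ≤ v then 4.4 * (d : ℝ) ^ (m + 1) * Real.sqrt (v / (2 * d))
  else if (2 - c) * d ≤ v then 4 * (d : ℝ) ^ (m + 1)
  else (d : ℝ) ^ (m + 1) * max 1 (d / (2 * v))

theorem phi_zero (m : ℕ) (c v : ℝ) : phi m c 0 v = 0 := by simp [phi]

theorem phi_ge (m : ℕ) (c : ℝ) (d : ℕ) (v : ℝ) (hd : d ≠ 0) :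
    (d : ℝ) ^ (m + 1) ≤ phi m c d v := by
  have hd1 : (1 : ℝ) ≤ d := by exact_mod_cast Nat.one_le_iff_ne_zero.2 hd
  have hp : 0 < (d : ℝ) ^ (m + 1) := by positivity
  unfold phi
  rw [if_neg hd]
  split_ifs with h1 h2
  · have : 1 ≤ Real.sqrt (v / (2 * d)) := by
      rw [Real.one_le_sqrt, le_div_iff₀ (by positivity)]; linarith
    nlinarith
  · linarith
  · exact le_mul_of_one_le_right hp.le (le_max_left _ _)

theorem phi_ge_one (m : ℕ) (c : ℝ) (d : ℕ) (v : ℝ) (hd : d ≠ 0) : 1 ≤ phi m c d v := by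
  have hd1 : (1 : ℝ) ≤ d := by exact_mod_cast Nat.one_le_iff_ne_zero.2 hd
  exact (one_le_pow₀ hd1).trans (phi_ge m c d v hd)

theorem phi_nonneg (m : ℕ) (c : ℝ) (d : ℕ) (v : ℝ) : 0 ≤ phi m c d v := by
  by_cases hd : d = 0
  · subst hd; rw [phi_zero]
  · linarith [phi_ge_one m c d v hd]

/-- Below `(2 - c) d`, failing multiplies the potential by at most `1 / β`. -/
theorem phi_fail_low (m : ℕ) (c β : ℝ) (d : ℕ) (v : ℝ) (hd : d ≠ 0) (hc : c ≤ 0.2)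
    (hβ0 : 1 / 2 < β) (hβ : β ≤ 0.9) (hv : 1 ≤ v) (hlow : v < (2 - c) * d) (hc0 : 0 < c) :
    phi m c d (max 1 (β * v)) ≤ (1 / β) * phi m c d v := by
  have hd1 : (1 : ℝ) ≤ d := by exact_mod_cast Nat.one_le_iff_ne_zero.2 hd
  have hp : 0 < (d : ℝ) ^ (m + 1) := by positivity
  have hm : max 1 (β * v) < (2 - c) * d := max_lt (by nlinarith) (by nlinarith)
  have hlow2 : v < 2 * d := by nlinarith
  unfold phi
  rw [if_neg hd, if_neg hd, if_neg (by nlinarith), if_neg (by linarith), if_neg (by linarith),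
    if_neg (by linarith)]
  have hb : 1 ≤ 1 / β := by rw [le_div_iff₀ (by linarith)]; linarith
  have key : max 1 ((d : ℝ) / (2 * max 1 (β * v))) ≤ (1 / β) * max 1 (d / (2 * v)) := by
    refine max_le ?_ ?_
    · have := le_max_left 1 ((d : ℝ) / (2 * v))
      nlinarith
    · calc (d : ℝ) / (2 * max 1 (β * v)) ≤ d / (2 * (β * v)) := by
            have : 0 < β * v := by nlinarith
            gcongr
            exact le_max_right _ _
        _ = (1 / β) * (d / (2 * v)) := by field_simp
        _ ≤ _ := by gcongr; exact le_max_right _ _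
  calc _ ≤ (d : ℝ) ^ (m + 1) * ((1 / β) * max 1 (d / (2 * v))) := by gcongr
    _ = _ := by ring

theorem phi_kill (m : ℕ) (c κ α : ℝ) (d e : ℕ) (v : ℝ) (hd : d ≠ 0)
    (hα : 1 < α) (hα2 : α ≤ 2) (hκ : (1 - κ) ^ m ≤ 1 / 18) (hκ1 : κ ≤ 1) (hκ0 : 0 < κ)
    (hv : (d : ℝ) / 4 ≤ v) (hv2 : v ≤ 2 * d)
    (he : (e : ℝ) ≤ (1 - κ) * d) :
    phi m c e (α * v) ≤ (1 / 2) * (d : ℝ) ^ (m + 1) := by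
  have hd1 : (1 : ℝ) ≤ d := by exact_mod_cast Nat.one_le_iff_ne_zero.2 hd
  have hp : 0 < (d : ℝ) ^ (m + 1) := by positivity
  by_cases he0 : e = 0
  · subst he0; rw [phi_zero]; positivity
  have he1 : (1 : ℝ) ≤ e := by exact_mod_cast Nat.one_le_iff_ne_zero.2 he0
  have hed : (e : ℝ) ≤ d := by nlinarith
  have hem : (e : ℝ) ^ m ≤ (1 / 18) * (d : ℝ) ^ m := by
    calc (e : ℝ) ^ m ≤ ((1 - κ) * d) ^ m := by gcongr
      _ = (1 - κ) ^ m * (d : ℝ) ^ m := mul_pow _ _ _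
      _ ≤ _ := by gcongr
  have hem' : (e : ℝ) ^ m * d ≤ (1 / 18) * (d : ℝ) ^ (m + 1) := by
    rw [pow_succ, ← mul_assoc]; gcongr
  have hee : (e : ℝ) ^ (m + 1) ≤ (e : ℝ) ^ m * d := by
    rw [pow_succ]; gcongr
  have hee0 : 0 < (e : ℝ) ^ m := by positivity
  unfold phi
  rw [if_neg he0]
  split_ifs with h1 h2
  · have hs : Real.sqrt (α * v / (2 * e)) ≤ 2 * d / e := by
      have h1le : (1 : ℝ) ≤ 2 * d / e := by rw [le_div_iff₀ (by linarith)]; linarith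
      rw [Real.sqrt_le_left (by positivity)]
      have hv0 : 0 ≤ v := by linarith
      calc α * v / (2 * e) ≤ 2 * (2 * d) / (2 * e) := by gcongr
        _ = 2 * d / e := by field_simp
        _ ≤ _ := by nlinarith
    calc 4.4 * (e : ℝ) ^ (m + 1) * Real.sqrt (α * v / (2 * e))
        ≤ 4.4 * (e : ℝ) ^ (m + 1) * (2 * d / e) := by gcongr
      _ = 8.8 * ((e : ℝ) ^ m * d) := by rw [pow_succ]; field_simp; norm_num
      _ ≤ _ := by linarith
  · linarith
  · have : max 1 ((e : ℝ) / (2 * (α * v))) ≤ 2 := by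
      refine max_le (by norm_num) ?_
      have : 0 < v := by linarith
      rw [div_le_iff₀ (by positivity)]
      nlinarith
    calc _ ≤ (e : ℝ) ^ (m + 1) * 2 := by gcongr
      _ ≤ _ := by linarith

set_option maxHeartbeats 1000000 in
/-- The drift of a single coordinate when the toward move is improving. -/
theorem drift_success (m : ℕ) (c κ α β δ : ℝ) (d k e : ℕ) (v : ℝ)
    (hα : 1 < α) (hα2 : α ≤ 2) (hβ0 : 1 / 2 < β) (hβ : β ≤ 0.9)
    (hc0 : 0 < c) (hc : c ≤ 0.2) (hcα : 1 ≤ α * (1 - c / 2))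
    (hκ : (1 - κ) ^ m ≤ 1 / 18) (hκ8 : κ ≤ 1 / 8) (hκc : κ ≤ c) (hκ0 : 0 < κ)
    (hδ1 : δ ≤ 0.05) (hδ2 : (1 / α + 1 / β) ≤ 2 * (1 - δ))
    (hd : d ≠ 0) (hv : 1 ≤ v) (hk : (k : ℝ) ≤ v) (hk2 : v / 2 ≤ k)
    (hlt : v < 2 * d) (he : (e : ℝ) = |(d : ℝ) - k|) :
    phi m c e (α * v) + phi m c d (max 1 (β * v)) ≤ 2 * (1 - δ) * phi m c d v := by
  have hd1 : (1 : ℝ) ≤ d := by exact_mod_cast Nat.one_le_iff_ne_zero.2 hd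
  have hp : 0 < (d : ℝ) ^ (m + 1) := by positivity
  have hphi := phi_ge m c d v hd
  by_cases hA : (2 - c) * d ≤ v
  · -- top zone
    have hmx : max 1 (β * v) < (2 - c) * d := max_lt (by nlinarith) (by nlinarith)
    have hmx2 : (d : ℝ) ≤ 2 * max 1 (β * v) := by
      have := le_max_right 1 (β * v); nlinarith
    have e1 : phi m c d (max 1 (β * v)) = (d : ℝ) ^ (m + 1) := by
      unfold phi
      rw [if_neg hd, if_neg (by nlinarith), if_neg (by linarith), max_eq_left, mul_one]
      rw [div_le_one (by positivity)]; exact hmx2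
    have e2 : phi m c d v = 4 * (d : ℝ) ^ (m + 1) := by
      unfold phi
      rw [if_neg hd, if_neg (by linarith), if_pos hA]
    have e3 : phi m c e (α * v) ≤ 6.24 * (d : ℝ) ^ (m + 1) := by
      by_cases he0 : e = 0
      · subst he0; rw [phi_zero]; positivity
      have he1 : (1 : ℝ) ≤ e := by exact_mod_cast Nat.one_le_iff_ne_zero.2 he0
      have hed : (e : ℝ) ≤ d := by
        rw [he, abs_le]; constructor <;> linarith
      have hhi : 2 * (e : ℝ) ≤ α * v := by nlinarith
      unfold phi
      rw [if_neg he0, if_pos hhi]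
      have hs : (e : ℝ) ^ (m + 1) * Real.sqrt (α * v / (2 * e)) ≤
          (d : ℝ) ^ (m + 1) * 1.415 := by
        have hs1 : (e : ℝ) * Real.sqrt (α * v / (2 * e)) ≤ d * 1.415 := by
          have : Real.sqrt (α * v / (2 * e)) ≤ d * 1.415 / e := by
            rw [Real.sqrt_le_left (by positivity), div_pow, div_le_div_iff₀ (by positivity) (by positivity)]
            have h4 : α * v ≤ 4 * d := by nlinarith
            have h5 : (e : ℝ) * d ≤ d * d := by nlinarith
            calc α * v * (e : ℝ) ^ 2 ≤ 4 * (d : ℝ) * (e : ℝ) ^ 2 := by gcongr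
              _ = 4 * (e : ℝ) * ((e : ℝ) * d) := by ring
              _ ≤ 4 * (e : ℝ) * ((d : ℝ) * d) := by gcongr
              _ ≤ ((d : ℝ) * 1.415) ^ 2 * (2 * e) := by
                have : 0 < (d : ℝ) * d * e := by positivity
                linarith
          rw [le_div_iff₀ (by linarith)] at this
          linarith
        calc (e : ℝ) ^ (m + 1) * Real.sqrt (α * v / (2 * e))
            = (e : ℝ) ^ m * (e * Real.sqrt (α * v / (2 * e))) := by ring
          _ ≤ (d : ℝ) ^ m * (d * 1.415) := by gcongr
          _ = _ := by ring
      nlinarith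
    rw [e1, e2]
    nlinarith
  · push Not at hA
    have hf := phi_fail_low m c β d v hd hc hβ0 hβ hv hA hc0
    by_cases hB : (d : ℝ) / 4 ≤ v
    · -- kill zone
      have hκe : (e : ℝ) ≤ (1 - κ) * d := by
        rw [he, abs_le]; constructor <;> nlinarith
      have hkill := phi_kill m c κ α d e v hd hα hα2 hκ (by linarith) hκ0 hB hlt.le hκe
      have : 1 / 2 ≤ 1 / α := by gcongr
      nlinarith
    · -- small zone
      push Not at hB
      have hed : (e : ℝ) = d - k := by rw [he, abs_of_nonneg]; linarith
      have he34 : 3 / 4 * (d : ℝ) ≤ e := by linarith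
      have he0 : e ≠ 0 := by
        rintro rfl
        norm_num at he34
        linarith
      have hedn : e ≤ d := by
        have : (e : ℝ) ≤ d := by linarith
        exact_mod_cast this
      have hs : phi m c e (α * v) ≤ 1 / α * phi m c d v := by
        unfold phi
        rw [if_neg he0, if_neg hd, if_neg (by nlinarith), if_neg (by nlinarith),
          if_neg (by linarith), if_neg (by linarith)]
        have h1 : max 1 ((d : ℝ) / (2 * v)) = d / (2 * v) := by
          apply max_eq_right
          rw [le_div_iff₀ (by positivity)]; linarith
        have h2 : max 1 ((e : ℝ) / (2 * (α * v))) ≤ 1 / α * (d / (2 * v)) := by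
          have : 1 / α * ((d : ℝ) / (2 * v)) = d / (2 * (α * v)) := by field_simp
          rw [this]
          refine max_le ?_ ?_
          · rw [le_div_iff₀ (by positivity)]; nlinarith
          · gcongr
        rw [h1]
        calc _ ≤ (d : ℝ) ^ (m + 1) * (1 / α * (d / (2 * v))) := by
              gcongr
          _ = _ := by ring
      nlinarith

/-- The drift of a single coordinate when the velocity is too large. -/
theorem drift_high (m : ℕ) (c β : ℝ) (d : ℕ) (v : ℝ)
    (hβ0 : 1 / 2 < β) (hβ : β ≤ 0.9) (hc0 : 0 < c) (hc : c ≤ 0.2)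
    (hd : d ≠ 0) (hge : 2 * d ≤ v) :
    phi m c d (max 1 (β * v)) ≤ 0.95 * phi m c d v := by
  have hd1 : (1 : ℝ) ≤ d := by exact_mod_cast Nat.one_le_iff_ne_zero.2 hd
  have hp : 0 < (d : ℝ) ^ (m + 1) := by positivity
  have hm : max 1 (β * v) = β * v := max_eq_right (by nlinarith)
  rw [hm]
  have h1s : 1 ≤ Real.sqrt (v / (2 * d)) := by
    rw [Real.one_le_sqrt, le_div_iff₀ (by positivity)]; linarith
  have e1 : phi m c d v = 4.4 * (d : ℝ) ^ (m + 1) * Real.sqrt (v / (2 * d)) := by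
    unfold phi; rw [if_neg hd, if_pos hge]
  rw [e1]
  unfold phi
  rw [if_neg hd]
  split_ifs with h1 h2
  · have : Real.sqrt (β * v / (2 * d)) ≤ 0.95 * Real.sqrt (v / (2 * d)) := by
      rw [mul_div_assoc, Real.sqrt_mul (by linarith)]
      have : Real.sqrt β ≤ 0.95 := by
        rw [Real.sqrt_le_left (by norm_num)]; norm_num; linarith
      gcongr
    calc _ ≤ 4.4 * (d : ℝ) ^ (m + 1) * (0.95 * Real.sqrt (v / (2 * d))) := by gcongr
      _ = _ := by ring
  · nlinarith
  · rw [max_eq_left]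
    · nlinarith
    · have : 0 < v := by linarith
      rw [div_le_one (by positivity)]; nlinarith

/-- The one-coordinate new potential if the offspring has distance `e`. -/
noncomputable def stepPhi (m : ℕ) (c α β : ℝ) (d e : ℕ) (v : ℝ) : ℝ :=
  phi m c (if e ≤ d then e else d) (if e < d then α * v else max 1 (β * v))

theorem coord_drift (m : ℕ) (c κ α β δ : ℝ) (z : ℤ) (v : ℝ)
    (hα : 1 < α) (hα2 : α ≤ 2) (hβ0 : 1 / 2 < β) (hβ : β ≤ 0.9)
    (hc0 : 0 < c) (hc : c ≤ 0.2) (hcα : 1 ≤ α * (1 - c / 2))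
    (hκ : (1 - κ) ^ m ≤ 1 / 18) (hκ8 : κ ≤ 1 / 8) (hκc : κ ≤ c) (hκ0 : 0 < κ)
    (hδ1 : δ ≤ 0.05) (hδ2 : (1 / α + 1 / β) ≤ 2 * (1 - δ)) (hv : 1 ≤ v) :
    stepPhi m c α β z.natAbs (z + ⌊v⌋).natAbs v + stepPhi m c α β z.natAbs (z + -⌊v⌋).natAbs v
      ≤ 2 * (1 - δ) * phi m c z.natAbs v := by
  obtain ⟨k, hk⟩ : ∃ k : ℕ, ⌊v⌋ = k := Int.eq_ofNat_of_zero_le (Int.floor_nonneg.2 (by linarith))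
  have hk1 : 1 ≤ k := by
    have : (1 : ℤ) ≤ ⌊v⌋ := Int.le_floor.2 (by simpa using hv)
    omega
  have hkv : (k : ℝ) ≤ v := by
    have := Int.floor_le v; rw [hk] at this; exact_mod_cast this
  have hvk : v < k + 1 := by
    have := Int.lt_floor_add_one v; rw [hk] at this; exact_mod_cast this
  have hk1' : (1 : ℝ) ≤ k := by exact_mod_cast hk1
  rw [hk]
  have main : ∀ d : ℕ, stepPhi m c α β d (d + k) v + stepPhi m c α β d ((d : ℤ) - k).natAbs v
      ≤ 2 * (1 - δ) * phi m c d v := by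
    intro d
    have hA : stepPhi m c α β d (d + k) v = phi m c d (max 1 (β * v)) := by
      unfold stepPhi
      rw [if_neg (by omega), if_neg (by omega)]
    rw [hA]
    by_cases hd : d = 0
    · subst hd
      unfold stepPhi
      rw [if_neg (by omega), phi_zero, phi_zero, phi_zero]; simp
    by_cases hlt : k < 2 * d
    · have hB : stepPhi m c α β d ((d : ℤ) - k).natAbs v =
          phi m c ((d : ℤ) - k).natAbs (α * v) := by
        unfold stepPhi
        rw [if_pos (by omega), if_pos (by omega)]
      rw [hB, add_comm]
      refine drift_success m c κ α β δ d k _ v hα hα2 hβ0 hβ hc0 hc hcα hκ hκ8 hκc hκ0 hδ1 hδ2 hd hv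
        hkv (by linarith) ?_ ?_
      · have : (k : ℝ) + 1 ≤ 2 * d := by exact_mod_cast hlt
        linarith
      · rw [Nat.cast_natAbs]; push_cast; rfl
    · have hB : stepPhi m c α β d ((d : ℤ) - k).natAbs v = phi m c d (max 1 (β * v)) := by
        unfold stepPhi
        rw [if_neg (show ¬ ((d : ℤ) - k).natAbs < d by omega)]
        congr 1
        split_ifs <;> omega
      rw [hB]
      have h2d : 2 * (d : ℝ) ≤ k := by exact_mod_cast (not_lt.1 hlt)
      have := drift_high m c β d v hβ0 hβ hc0 hc hd (by linarith)
      have := phi_nonneg m c d v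
      nlinarith
  rcases Int.natAbs_eq z with h | h
  · have := main z.natAbs
    have a1 : (z + k).natAbs = z.natAbs + k := by omega
    have a2 : (z + -k).natAbs = ((z.natAbs : ℤ) - k).natAbs := by omega
    rw [a1, a2]; exact this
  · have := main z.natAbs
    have a1 : (z + -k).natAbs = z.natAbs + k := by omega
    have a2 : (z + k).natAbs = ((z.natAbs : ℤ) - k).natAbs := by omega
    rw [a1, a2, add_comm]; exact this

theorem fitness_update {n : ℕ} (a x : Fin n → ℤ) (i : Fin n) (y : ℤ) :
    fitness a (Function.update x i y) + (x i - a i).natAbs =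
      fitness a x + (y - a i).natAbs := by
  unfold fitness
  rw [← Finset.add_sum_erase _ _ (Finset.mem_univ i),
    ← Finset.add_sum_erase (a := i) Finset.univ (fun j => (x j - a j).natAbs) (Finset.mem_univ i)]
  have : ∑ j ∈ Finset.univ.erase i, (Function.update x i y j - a j).natAbs =
      ∑ j ∈ Finset.univ.erase i, (x j - a j).natAbs := by
    refine Finset.sum_congr rfl fun j hj => ?_
    rw [Function.update_of_ne (Finset.ne_of_mem_erase hj)]
  rw [this, Function.update_self]
  omega

/-- Real total potential. -/
noncomputable def totPhi {n : ℕ} (m : ℕ) (c : ℝ) (a : Fin n → ℤ) (s : RlsState n) : ℝ :=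
  ∑ i, phi m c (s.1 i - a i).natAbs (s.2 i)

theorem totPhi_update {n : ℕ} (m : ℕ) (c α β : ℝ) (a : Fin n → ℤ) (s : RlsState n)
    (i : Fin n) (b : Bool) :
    totPhi m c a (rlsUpdate a α β s i b) = totPhi m c a s - phi m c (s.1 i - a i).natAbs (s.2 i)
      + stepPhi m c α β (s.1 i - a i).natAbs
        (s.1 i - a i + (if b then ⌊s.2 i⌋ else -⌊s.2 i⌋)).natAbs (s.2 i) := by
  set w : ℤ := (if b then ⌊s.2 i⌋ else -⌊s.2 i⌋) with hw
  have hf := fitness_update a s.1 i (s.1 i + w)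
  have h0 : s.1 i + w - a i = s.1 i - a i + w := by ring
  rw [h0] at hf
  unfold totPhi
  rw [← Finset.add_sum_erase _ _ (Finset.mem_univ i),
    ← Finset.add_sum_erase (a := i) Finset.univ (fun j => phi m c (s.1 j - a j).natAbs (s.2 j))
      (Finset.mem_univ i)]
  have e1 : ∀ j ∈ Finset.univ.erase i,
      phi m c ((rlsUpdate a α β s i b).1 j - a j).natAbs ((rlsUpdate a α β s i b).2 j) =
      phi m c (s.1 j - a j).natAbs (s.2 j) := by
    intro j hj
    have hne := Finset.ne_of_mem_erase hj
    have p1 : (rlsUpdate a α β s i b).1 j = s.1 j := by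
      simp only [rlsUpdate]
      split_ifs <;> simp [Function.update_of_ne hne]
    have p2 : (rlsUpdate a α β s i b).2 j = s.2 j := by
      simp only [rlsUpdate]
      rw [Function.update_of_ne hne]
    rw [p1, p2]
  rw [Finset.sum_congr rfl e1]
  have e2 : phi m c ((rlsUpdate a α β s i b).1 i - a i).natAbs ((rlsUpdate a α β s i b).2 i) =
      stepPhi m c α β (s.1 i - a i).natAbs (s.1 i - a i + w).natAbs (s.2 i) := by
    unfold stepPhi
    congr 1
    · simp only [rlsUpdate]
      rw [← hw]
      by_cases h : (s.1 i - a i + w).natAbs ≤ (s.1 i - a i).natAbs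
      · rw [if_pos h, if_pos (by omega), Function.update_self, h0]
      · rw [if_neg h, if_neg (by omega)]
    · simp only [rlsUpdate]
      rw [← hw, Function.update_self]
      by_cases h : (s.1 i - a i + w).natAbs < (s.1 i - a i).natAbs
      · rw [if_pos h, if_pos (by omega)]
      · rw [if_neg h, if_neg (by omega)]
  rw [e2]
  ring

theorem good_update {n : ℕ} (a : Fin n → ℤ) (α β : ℝ) (hα : 1 < α) (s : RlsState n)
    (hs : ∀ i, 1 ≤ s.2 i) (i : Fin n) (b : Bool) : ∀ j, 1 ≤ (rlsUpdate a α β s i b).2 j := by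
  intro j
  simp only [rlsUpdate]
  by_cases h : j = i
  · subst h
    rw [Function.update_self]
    have := hs j
    split_ifs
    · nlinarith
    · exact le_max_left _ _
    · nlinarith
    · exact le_max_left _ _
  · rw [Function.update_of_ne h]; exact hs j

theorem trans_sum {n : ℕ} (a : Fin n → ℤ) (α β : ℝ) (s : RlsState n) (F : RlsState n → ℝ≥0∞) :
    ∑' s', rlsTransP a α β s s' * F s' =
      ∑ i : Fin n, ∑ b : Bool, (1 / (2 * (n : ℝ≥0∞))) * F (rlsUpdate a α β s i b) := by
  have h : ∀ s', rlsTransP a α β s s' * F s' = ∑ i : Fin n, ∑ b : Bool,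
      (1 / (2 * (n : ℝ≥0∞))) *
        (if s' = rlsUpdate a α β s i b then F (rlsUpdate a α β s i b) else 0) := by
    intro s'
    unfold rlsTransP
    rw [Finset.sum_mul]
    refine Finset.sum_congr rfl fun i _ => ?_
    rw [Finset.sum_mul]
    refine Finset.sum_congr rfl fun b _ => ?_
    split_ifs with h
    · rw [mul_one, h]
    · simp
  simp_rw [h]
  rw [Summable.tsum_finsetSum (fun _ _ => ENNReal.summable)]
  refine Finset.sum_congr rfl fun i _ => ?_
  rw [Summable.tsum_finsetSum (fun _ _ => ENNReal.summable)]
  refine Finset.sum_congr rfl fun b _ => ?_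
  rw [ENNReal.tsum_mul_left, tsum_ite_eq]

theorem dist_drift {n : ℕ} (a : Fin n → ℤ) (α β : ℝ) (F : RlsState n → ℝ≥0∞) (r : ℝ≥0∞)
    (hF : ∀ s, ∑' s', rlsTransP a α β s s' * F s' ≤ r * F s) (t : ℕ) :
    ∑' s, rlsDist n a α β t s * F s ≤ r ^ t * F ((fun _ => 0), fun _ => 1) := by
  induction t with
  | zero =>
    have : ∀ s, rlsDist n a α β 0 s * F s =
        if s = ((fun _ => 0), fun _ => 1) then F ((fun _ => 0), fun _ => 1) else 0 := by
      intro s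
      simp only [rlsDist]
      split_ifs with h
      · rw [one_mul, h]
      · rw [zero_mul]
    simp_rw [this]
    rw [tsum_ite_eq]; simp
  | succ t ih =>
    calc ∑' s', rlsDist n a α β (t + 1) s' * F s'
        = ∑' s', ∑' s, rlsDist n a α β t s * (rlsTransP a α β s s' * F s') := by
          refine tsum_congr fun s' => ?_
          simp only [rlsDist]
          rw [← ENNReal.tsum_mul_right]
          simp_rw [mul_assoc]
      _ = ∑' s, rlsDist n a α β t s * ∑' s', rlsTransP a α β s s' * F s' := by
          rw [ENNReal.tsum_comm]
          simp_rw [ENNReal.tsum_mul_left]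
      _ ≤ ∑' s, r * (rlsDist n a α β t s * F s) := by
          refine ENNReal.tsum_le_tsum fun s => ?_
          calc _ ≤ rlsDist n a α β t s * (r * F s) := by gcongr; exact hF s
            _ = _ := by ring
      _ = r * ∑' s, rlsDist n a α β t s * F s := ENNReal.tsum_mul_left
      _ ≤ r * (r ^ t * F ((fun _ => 0), fun _ => 1)) := by gcongr
      _ = _ := by ring

open Classical in
/-- Extended potential, infinite at unreachable states. -/
noncomputable def extPhi {n : ℕ} (m : ℕ) (c : ℝ) (a : Fin n → ℤ) (s : RlsState n) : ℝ≥0∞ :=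
  if ∀ i, 1 ≤ s.2 i then ENNReal.ofReal (totPhi m c a s) else ⊤

theorem totPhi_nonneg {n : ℕ} (m : ℕ) (c : ℝ) (a : Fin n → ℤ) (s : RlsState n) :
    0 ≤ totPhi m c a s := Finset.sum_nonneg fun _ _ => phi_nonneg _ _ _ _

theorem extPhi_ge_one {n : ℕ} (m : ℕ) (c : ℝ) (a : Fin n → ℤ) (s : RlsState n)
    (h : fitness a s.1 ≠ 0) : 1 ≤ extPhi m c a s := by
  unfold extPhi
  split_ifs
  · rw [ENNReal.one_le_ofReal]
    obtain ⟨i, -, hi⟩ := Finset.exists_ne_zero_of_sum_ne_zero h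
    exact (phi_ge_one m c _ (s.2 i) hi).trans
      (Finset.single_le_sum (f := fun i => phi m c (s.1 i - a i).natAbs (s.2 i))
        (fun _ _ => phi_nonneg _ _ _ _) (Finset.mem_univ i))
  · exact le_top

theorem extPhi_drift {n : ℕ} (hn : 0 < n) (m : ℕ) (c α β δ : ℝ) (a : Fin n → ℤ)
    (hα : 1 < α) (hδ : δ < 1)
    (hstep : ∀ (z : ℤ) (v : ℝ), 1 ≤ v →
      stepPhi m c α β z.natAbs (z + ⌊v⌋).natAbs v + stepPhi m c α β z.natAbs (z + -⌊v⌋).natAbs v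
      ≤ 2 * (1 - δ) * phi m c z.natAbs v) (s : RlsState n) :
    ∑' s', rlsTransP a α β s s' * extPhi m c a s' ≤
      ENNReal.ofReal (1 - δ / n) * extPhi m c a s := by
  have hn1 : (1 : ℝ) ≤ n := by exact_mod_cast hn
  have hr : 0 < 1 - δ / n := by
    rw [sub_pos, div_lt_one (by linarith)]; linarith
  by_cases hs : ∀ i, 1 ≤ s.2 i
  · rw [trans_sum]
    have e1 : ∀ i b, extPhi m c a (rlsUpdate a α β s i b) =
        ENNReal.ofReal (totPhi m c a (rlsUpdate a α β s i b)) := by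
      intro i b
      unfold extPhi
      rw [if_pos (good_update a α β hα s hs i b)]
    have e2 : (1 / (2 * (n : ℝ≥0∞))) = ENNReal.ofReal (1 / (2 * n)) := by
      rw [ENNReal.ofReal_div_of_pos (by positivity), ENNReal.ofReal_mul (by norm_num)]
      simp
    have e3 : extPhi m c a s = ENNReal.ofReal (totPhi m c a s) := by
      unfold extPhi; rw [if_pos hs]
    rw [e3, ← ENNReal.ofReal_mul hr.le]
    simp_rw [e1, e2]
    have e4 : ∀ i, ∑ b : Bool, ENNReal.ofReal (1 / (2 * n)) *
        ENNReal.ofReal (totPhi m c a (rlsUpdate a α β s i b)) =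
        ENNReal.ofReal (1 / (2 * n) * (totPhi m c a (rlsUpdate a α β s i true)
          + totPhi m c a (rlsUpdate a α β s i false))) := by
      intro i
      rw [Fintype.sum_bool, mul_add, ENNReal.ofReal_add, ENNReal.ofReal_mul, ENNReal.ofReal_mul]
      · positivity
      · positivity
      · exact mul_nonneg (by positivity) (totPhi_nonneg _ _ _ _)
      · exact mul_nonneg (by positivity) (totPhi_nonneg _ _ _ _)
    simp_rw [e4]
    rw [← ENNReal.ofReal_sum_of_nonneg]
    · apply ENNReal.ofReal_le_ofReal
      calc ∑ i, 1 / (2 * (n : ℝ)) * (totPhi m c a (rlsUpdate a α β s i true)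
          + totPhi m c a (rlsUpdate a α β s i false))
          ≤ ∑ i, 1 / (2 * (n : ℝ)) * (2 * totPhi m c a s
              - 2 * δ * phi m c (s.1 i - a i).natAbs (s.2 i)) := by
            refine Finset.sum_le_sum fun i _ => ?_
            refine mul_le_mul_of_nonneg_left ?_ (by positivity)
            rw [totPhi_update, totPhi_update]
            have := hstep (s.1 i - a i) (s.2 i) (hs i)
            simp only [if_true, Bool.false_eq_true, if_false]
            linarith
        _ = 1 / (2 * (n : ℝ)) * (n * (2 * totPhi m c a s) - 2 * δ * totPhi m c a s) := by
            rw [← Finset.mul_sum, Finset.sum_sub_distrib, Finset.sum_const,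
              Finset.card_univ, Fintype.card_fin, nsmul_eq_mul, ← Finset.mul_sum]
            rfl
        _ = _ := by field_simp
    · intro i _
      exact mul_nonneg (by positivity) (add_nonneg (totPhi_nonneg _ _ _ _) (totPhi_nonneg _ _ _ _))
  · have : extPhi m c a s = ⊤ := by unfold extPhi; rw [if_neg hs]
    rw [this, ENNReal.mul_top (by simpa using hr)]
    exact le_top

theorem one_drift {n : ℕ} (hn : 0 < n) (α β : ℝ) (a : Fin n → ℤ) (s : RlsState n) :
    ∑' s', rlsTransP a α β s s' * (fun _ => 1 : RlsState n → ℝ≥0∞) s' ≤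
      1 * (fun _ => 1 : RlsState n → ℝ≥0∞) s := by
  rw [trans_sum]
  simp only [mul_one, Finset.sum_const, Finset.card_univ, Fintype.card_bool, Fintype.card_fin,
    nsmul_eq_mul]
  have h2 : (2 * (n : ℝ≥0∞)) ≠ 0 := by simp; omega
  have h3 : (2 * (n : ℝ≥0∞)) ≠ ⊤ := ENNReal.mul_ne_top (by simp) (by simp)
  calc _ = (2 * (n : ℝ≥0∞)) * (1 / (2 * (n : ℝ≥0∞))) := by push_cast; ring
    _ ≤ _ := by rw [one_div, ENNReal.mul_inv_cancel h2 h3]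

theorem init_bound {n : ℕ} (m : ℕ) (c : ℝ) (hc : c ≤ 0.2) (hc0 : 0 < c) (a : Fin n → ℤ) :
    extPhi m c a ((fun _ => 0), fun _ => 1) ≤ ENNReal.ofReal ((normOne a : ℝ) ^ (m + 2)) := by
  unfold extPhi
  rw [if_pos (fun _ => le_rfl)]
  apply ENNReal.ofReal_le_ofReal
  have h1 : ∀ d : ℕ, phi m c d 1 ≤ (d : ℝ) ^ (m + 2) := by
    intro d
    by_cases hd : d = 0
    · subst hd; rw [phi_zero]; positivity
    have hd1 : (1 : ℝ) ≤ d := by exact_mod_cast Nat.one_le_iff_ne_zero.2 hd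
    unfold phi
    rw [if_neg hd, if_neg (by linarith), if_neg (by nlinarith), pow_succ _ (m + 1)]
    gcongr
    exact max_le hd1 (by linarith)
  calc totPhi m c a ((fun _ => 0), fun _ => 1) ≤ ∑ i, ((a i).natAbs : ℝ) ^ (m + 2) := by
        unfold totPhi
        refine Finset.sum_le_sum fun i _ => ?_
        have := h1 (a i).natAbs
        simpa using this
    _ ≤ ∑ i, ((a i).natAbs : ℝ) * (normOne a : ℝ) ^ (m + 1) := by
        refine Finset.sum_le_sum fun i _ => ?_
        rw [pow_succ' _ (m + 1)]
        gcongr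
        exact Finset.single_le_sum (f := fun i => (a i).natAbs) (fun _ _ => Nat.zero_le _)
          (Finset.mem_univ i)
    _ = _ := by
        rw [← Finset.sum_mul, pow_succ' _ (m + 1)]
        simp [normOne]

/-- Summation of the tail bound. -/
theorem tail_sum (u : ℕ → ℝ≥0∞) (ρ G : ℝ) (hρ0 : 0 ≤ ρ) (hρ1 : ρ < 1) (hG : 0 ≤ G)
    (hu1 : ∀ t, u t ≤ 1) (hu2 : ∀ t, u t ≤ ENNReal.ofReal ρ ^ t * ENNReal.ofReal G) (N : ℕ) :
    ∑' t, u t ≤ ENNReal.ofReal (N + ρ ^ N * G / (1 - ρ)) := by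
  rw [← ENNReal.summable.sum_add_tsum_nat_add' (k := N),
    ENNReal.ofReal_add (by positivity) (div_nonneg (by positivity) (by linarith))]
  refine add_le_add ?_ ?_
  · calc ∑ i ∈ Finset.range N, u i ≤ ∑ i ∈ Finset.range N, 1 := Finset.sum_le_sum fun i _ => hu1 i
      _ = _ := by simp
  · have hs : HasSum (fun t => ρ ^ N * G * ρ ^ t) (ρ ^ N * G * (1 - ρ)⁻¹) :=
      (hasSum_geometric_of_lt_one hρ0 hρ1).mul_left _
    calc ∑' t, u (t + N) ≤ ∑' t, ENNReal.ofReal (ρ ^ N * G * ρ ^ t) := by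
          refine ENNReal.tsum_le_tsum fun t => (hu2 _).trans ?_
          rw [← ENNReal.ofReal_pow hρ0, ← ENNReal.ofReal_mul (by positivity)]
          apply ENNReal.ofReal_le_ofReal
          apply le_of_eq; ring
      _ = ENNReal.ofReal (ρ ^ N * G * (1 - ρ)⁻¹) := by
          rw [← ENNReal.ofReal_tsum_of_nonneg _ hs.summable, hs.tsum_eq]
          intro t; positivity
      _ = _ := by rw [div_eq_mul_inv]

theorem real_bound (n A m : ℕ) (δ : ℝ) (hn : 0 < n) (hA : 2 ≤ A) (hδ0 : 0 < δ) (hδ1 : δ ≤ 0.05) :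
    ∃ N : ℕ, N + (1 - δ / n) ^ N * (A : ℝ) ^ (m + 2) / (1 - (1 - δ / n)) ≤
      ((m + 6) / δ) * n * Real.log A := by
  have hn1 : (1 : ℝ) ≤ n := by exact_mod_cast hn
  have hA2 : (2 : ℝ) ≤ A := by exact_mod_cast hA
  have hlog : 1 / 2 ≤ Real.log A := by
    have h := Real.log_two_gt_d9
    have := Real.log_le_log (by norm_num) hA2
    linarith
  have hr : 0 ≤ 1 - δ / n := by
    rw [sub_nonneg, div_le_one (by linarith)]; linarith
  set L := (m + 2 : ℝ) * Real.log A with hL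
  have hL0 : 0 ≤ L := by positivity
  refine ⟨⌈n / δ * L⌉₊, ?_⟩
  set N := ⌈n / δ * L⌉₊ with hN
  have hN1 : n / δ * L ≤ N := Nat.le_ceil _
  have hN2 : (N : ℝ) < n / δ * L + 1 := Nat.ceil_lt_add_one (by positivity)
  have hpow : (1 - δ / n) ^ N * (A : ℝ) ^ (m + 2) ≤ 1 := by
    have h1 : (1 - δ / n) ^ N ≤ Real.exp (-L) := by
      calc (1 - δ / n) ^ N ≤ Real.exp (-(δ / n)) ^ N := by
            gcongr; exact Real.one_sub_le_exp_neg _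
        _ = Real.exp (N * (-(δ / n))) := by rw [← Real.exp_nat_mul]
        _ ≤ _ := by
            apply Real.exp_le_exp.2
            have : n / δ * L * (δ / n) ≤ N * (δ / n) := by gcongr
            have h : n / δ * L * (δ / n) = L := by field_simp
            linarith
    have h2 : (A : ℝ) ^ (m + 2) = Real.exp L := by
      rw [hL, show (m + 2 : ℝ) = ((m + 2 : ℕ) : ℝ) by push_cast; ring, Real.exp_nat_mul,
        Real.exp_log (by linarith)]
    rw [h2]
    calc _ ≤ Real.exp (-L) * Real.exp L := by gcongr
      _ = 1 := by rw [← Real.exp_add]; simp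
  have hd : (1 - δ / n) ^ N * (A : ℝ) ^ (m + 2) / (1 - (1 - δ / n)) ≤ n / δ := by
    calc _ ≤ 1 / (1 - (1 - δ / n)) := by
          have : 0 ≤ 1 - (1 - δ / n) := by
            have : 0 < δ / n := by positivity
            linarith
          gcongr
      _ = _ := by rw [sub_sub_cancel, one_div_div]
  have h1n : 1 ≤ n / δ := by rw [le_div_iff₀ hδ0]; linarith
  have : (m + 6) / δ * n * Real.log A = n / δ * L + 4 * (n / δ * Real.log A) := by
    rw [hL]; ring
  rw [this]
  nlinarith

/-- **Upper bound for self-adjusting RLS.**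
For all constants `α, β` satisfying `1 < α ≤ 2`, `1/2 < β ≤ 0.9`, `2αβ − β − α > 0`,
`α + β > 2` and `α²β > 1`, and every `a ∈ ℤⁿ \ {0ⁿ}` (with `|a|₁ ≥ 2`, so that
`log |a|₁ > 0`, as expressed by the asymptotic `O`-notation), the expected optimization
time of `RLS_{α,β}`, started with the all-`0` integer string and all-`1` velocity vector,
on `f_a` is `O(n · log |a|₁)`. -/
theorem rls_upper_bound (α β : ℝ) (hα₁ : 1 < α) (hα₂ : α ≤ 2)
    (hβ₁ : 1 / 2 < β) (hβ₂ : β ≤ 0.9)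
    (h1 : 0 < 2 * α * β - β - α) (h2 : 2 < α + β) (h3 : 1 < α ^ 2 * β) :
    ∃ C : ℝ, 0 < C ∧ ∀ (n : ℕ) (a : Fin n → ℤ), a ≠ 0 → 2 ≤ normOne a →
      rlsExpTime n a α β ≤ ENNReal.ofReal (C * n * Real.log (normOne a)) := by
  -- the constants
  obtain ⟨δ, hδ0, hδ1, hδ2⟩ : ∃ δ : ℝ, 0 < δ ∧ δ ≤ 0.05 ∧ (1 / α + 1 / β) ≤ 2 * (1 - δ) := by
    have : 1 / α + 1 / β < 2 := by
      rw [div_add_div _ _ (by linarith) (by linarith), div_lt_iff₀ (by nlinarith)]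
      linarith
    refine ⟨min 0.05 (1 - (1 / α + 1 / β) / 2), lt_min (by norm_num) (by linarith),
      min_le_left _ _, ?_⟩
    have := min_le_right 0.05 (1 - (1 / α + 1 / β) / 2)
    linarith
  obtain ⟨c, hc0, hc, hcα⟩ : ∃ c : ℝ, 0 < c ∧ c ≤ 0.2 ∧ 1 ≤ α * (1 - c / 2) := by
    refine ⟨min 0.2 (α - 1), lt_min (by norm_num) (by linarith), min_le_left _ _, ?_⟩
    have := min_le_right 0.2 (α - 1)
    nlinarith
  obtain ⟨κ, hκ0, hκ8, hκc⟩ : ∃ κ : ℝ, 0 < κ ∧ κ ≤ 1 / 8 ∧ κ ≤ c :=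
    ⟨min (1 / 8) c, lt_min (by norm_num) hc0, min_le_left _ _, min_le_right _ _⟩
  obtain ⟨m, hm⟩ : ∃ m : ℕ, (1 - κ) ^ m < 1 / 18 :=
    exists_pow_lt_of_lt_one (by norm_num) (by linarith)
  refine ⟨(m + 6) / δ, by positivity, ?_⟩
  intro n a ha hA
  have hn : 0 < n := by
    rcases Nat.eq_zero_or_pos n with h | h
    · subst h; exact absurd (Subsingleton.elim _ _) ha
    · exact h
  have hn1 : (1 : ℝ) ≤ n := by exact_mod_cast hn
  have hdiv : δ / n ≤ 1 := by rw [div_le_one (by linarith)]; linarith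
  have hdiv0 : 0 < δ / n := by positivity
  obtain ⟨N, hN⟩ := real_bound n (normOne a) m δ hn hA hδ0 hδ1
  refine le_trans ?_ (ENNReal.ofReal_le_ofReal hN)
  unfold rlsExpTime
  refine tail_sum _ _ _ (by linarith) (by linarith) (by positivity) ?_ ?_ N
  · intro t
    have := dist_drift a α β (fun _ => 1) 1 (one_drift hn α β a) t
    simp only [mul_one, one_pow] at this
    refine le_trans (ENNReal.tsum_le_tsum fun s => ?_) this
    split_ifs
    · exact zero_le
    · exact le_rfl
  · intro t
    have := dist_drift a α β (extPhi m c a) (ENNReal.ofReal (1 - δ / n))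
      (extPhi_drift hn m c α β δ a hα₁ (by linarith) (fun z v hv =>
        coord_drift m c κ α β δ z v hα₁ hα₂ hβ₁ hβ₂ hc0 hc hcα hm.le hκ8 hκc hκ0 hδ1 hδ2 hv)) t
    refine le_trans (le_trans (ENNReal.tsum_le_tsum fun s => ?_) this) ?_
    · split_ifs with h
      · exact zero_le
      · exact le_mul_of_one_le_right zero_le (extPhi_ge_one m c a s h)
    · gcongr
      exact init_bound m c hc hc0 a
end

section
/- RLS lower bound via the maximal component: For every a ∈ ℤⁿ \ {0ⁿ} and constants α with 1 < α ≤ 2 and β with 1/2 < β < 1, the expected optimization time of RLS_{α,β}, started with the all-0 integer string and all-1 velocity vector, on the fitness function f_a is Ω(n · log |a|_∞): since the velocity of any fixed entry at most doubles each time that entry is selected and each entry is selected with probability 1/n per iteration, the entry at distance |a|_∞ from its target requires at least log(|a|_∞) − 1 selections, giving expected time Ω(n · log |a|_∞) by additive drift. -/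
open scoped ENNReal BigOperators

namespace RlsAux

/-- size of the relevant coordinate plus its velocity -/
noncomputable def size {n : ℕ} (j : Fin n) (s : RlsState n) : ℝ := |(s.1 j : ℝ)| + max 1 |s.2 j|

noncomputable def pot {n : ℕ} (a : Fin n → ℤ) (j : Fin n) (s : RlsState n) : ℝ≥0∞ :=
  ENNReal.ofReal (Real.log (normInf a) - Real.log (size j s))

lemma one_le_size {n : ℕ} (j : Fin n) (s : RlsState n) : 1 ≤ size j s := by
  unfold size
  have := abs_nonneg (s.1 j : ℝ)
  have := le_max_left 1 |s.2 j|
  linarith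

lemma floor_abs (v : ℝ) : |((⌊v⌋ : ℤ) : ℝ)| ≤ 2 * max 1 |v| := by
  have h1 := Int.floor_le v
  have h2 := Int.lt_floor_add_one v
  have h3 := le_max_left 1 |v|
  have h4 := le_max_right 1 |v|
  have h5 := le_abs_self v
  have h6 := neg_abs_le v
  rw [abs_le]
  constructor <;> linarith

lemma size_update_ne {n : ℕ} (a : Fin n → ℤ) (α β : ℝ) (s : RlsState n) (i j : Fin n) (b : Bool)
    (h : j ≠ i) : size j (rlsUpdate a α β s i b) = size j s := by
  unfold size rlsUpdate
  dsimp only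
  split_ifs <;> simp [Function.update_of_ne h]

lemma vel_bound (α β : ℝ) (hα₁ : 1 < α) (hα₂ : α ≤ 2) (hβ₁ : 1 / 2 < β) (hβ₂ : β < 1) (v : ℝ)
    (p : Prop) [Decidable p] :
    max 1 |if p then α * v else max 1 (β * v)| ≤ 2 * max 1 |v| := by
  have h3 := le_max_left 1 |v|
  have h4 := le_max_right 1 |v|
  have h5 := abs_nonneg v
  apply max_le
  · linarith
  split_ifs
  · rw [abs_mul, abs_of_pos (by linarith)]
    nlinarith
  · rw [abs_of_pos (lt_of_lt_of_le one_pos (le_max_left _ _))]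
    apply max_le
    · linarith
    · have h6 : β * v ≤ β * |v| := by
        apply mul_le_mul_of_nonneg_left (le_abs_self v); linarith
      nlinarith

lemma size_update {n : ℕ} (a : Fin n → ℤ) (α β : ℝ) (hα₁ : 1 < α) (hα₂ : α ≤ 2)
    (hβ₁ : 1 / 2 < β) (hβ₂ : β < 1) (s : RlsState n) (j : Fin n) (b : Bool) :
    size j (rlsUpdate a α β s j b) ≤ 4 * size j s := by
  have hf := floor_abs (s.2 j)
  have h0 := abs_nonneg (s.1 j : ℝ)
  have h3 := le_max_left 1 |s.2 j|
  unfold size rlsUpdate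
  dsimp only
  have hv : ∀ (p : Prop) [Decidable p], max 1 |Function.update s.2 j
      (if p then α * s.2 j else max 1 (β * s.2 j)) j| ≤ 2 * max 1 |s.2 j| := by
    intro p _
    rw [Function.update_self]
    exact vel_bound α β hα₁ hα₂ hβ₁ hβ₂ _ p
  refine le_trans (add_le_add_right (hv _) _) ?_
  have hx : |((s.1 j + (if b then ⌊s.2 j⌋ else -⌊s.2 j⌋) : ℤ) : ℝ)|
      ≤ |(s.1 j : ℝ)| + 2 * max 1 |s.2 j| := by
    push_cast
    refine le_trans (abs_add_le _ _) ?_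
    cases b <;> simp [hf]
  generalize (s.1 j + (if b then ⌊s.2 j⌋ else -⌊s.2 j⌋) : ℤ) = z at hx ⊢
  split_ifs with hh
  · rw [Function.update_self]
    linarith
  · linarith

lemma pot_update {n : ℕ} (a : Fin n → ℤ) (α β : ℝ) (hα₁ : 1 < α) (hα₂ : α ≤ 2)
    (hβ₁ : 1 / 2 < β) (hβ₂ : β < 1) (s : RlsState n) (i j : Fin n) (b : Bool) :
    pot a j s ≤ pot a j (rlsUpdate a α β s i b) +
      (if i = j then ENNReal.ofReal (Real.log 4) else 0) := by
  split_ifs with h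
  · subst h
    have h1 := size_update a α β hα₁ hα₂ hβ₁ hβ₂ s i b
    have h2 := one_le_size i s
    have h3 := one_le_size i (rlsUpdate a α β s i b)
    have h4 : Real.log (size i (rlsUpdate a α β s i b)) ≤ Real.log 4 + Real.log (size i s) := by
      rw [← Real.log_mul (by norm_num) (by linarith)]
      exact Real.log_le_log (by linarith) h1
    unfold pot
    refine le_trans (ENNReal.ofReal_le_ofReal ?_) ENNReal.ofReal_add_le
    linarith
  · unfold pot
    rw [size_update_ne a α β s i j b (Ne.symm h), add_zero]

lemma pot_opt {n : ℕ} (a : Fin n → ℤ) (j : Fin n) (hj : (a j).natAbs = normInf a)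
    (hpos : 0 < normInf a) (s : RlsState n) (h : fitness a s.1 = 0) : pot a j s = 0 := by
  unfold pot
  rw [ENNReal.ofReal_eq_zero, sub_nonpos]
  apply Real.log_le_log (by exact_mod_cast hpos)
  have h1 : s.1 j = a j := by
    unfold fitness at h
    rw [Finset.sum_eq_zero_iff] at h
    have := h j (Finset.mem_univ _)
    omega
  unfold size
  rw [h1, ← hj, Nat.cast_natAbs, Int.cast_abs]
  have := le_max_left 1 |s.2 j|
  linarith

lemma pot_le {n : ℕ} (a : Fin n → ℤ) (j : Fin n) (s : RlsState n) :
    pot a j s ≤ ENNReal.ofReal (Real.log (normInf a)) := by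
  apply ENNReal.ofReal_le_ofReal
  have := Real.log_nonneg (one_le_size j s)
  linarith

noncomputable def Q (n : ℕ) (a : Fin n → ℤ) (α β : ℝ) (t : ℕ) : ℝ≥0∞ :=
  ∑' s : RlsState n, if fitness a s.1 = 0 then 0 else rlsDist n a α β t s

noncomputable def S (n : ℕ) (a : Fin n → ℤ) (α β : ℝ) (j : Fin n) (t : ℕ) : ℝ≥0∞ :=
  ∑' s : RlsState n, rlsDist n a α β t s * pot a j s

lemma trans_sum {n : ℕ} (a : Fin n → ℤ) (α β : ℝ) (s : RlsState n) (g : RlsState n → ℝ≥0∞) :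
    ∑' s', rlsTransP a α β s s' * g s' =
      ∑ i : Fin n, ∑ b : Bool, (1 / (2 * (n : ℝ≥0∞))) * g (rlsUpdate a α β s i b) := by
  unfold rlsTransP
  simp_rw [Finset.sum_mul]
  rw [Summable.tsum_finsetSum (fun _ _ => ENNReal.summable)]
  refine Finset.sum_congr rfl fun i _ => ?_
  rw [Summable.tsum_finsetSum (fun _ _ => ENNReal.summable)]
  refine Finset.sum_congr rfl fun b _ => ?_
  rw [tsum_eq_single (rlsUpdate a α β s i b)]
  · simp
  · intro s' hs'
    simp [hs']

lemma const_sum {n : ℕ} (hn : n ≠ 0) (c : ℝ≥0∞) :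
    ∑ _i : Fin n, ∑ _b : Bool, (1 / (2 * (n : ℝ≥0∞))) * c = c := by
  simp only [Finset.sum_const, Finset.card_univ, Fintype.card_fin, Fintype.card_bool,
    nsmul_eq_mul, one_div]
  have h : (2 * (n : ℝ≥0∞)) * (2 * (n : ℝ≥0∞))⁻¹ = 1 :=
    ENNReal.mul_inv_cancel (by simp [hn]) (ENNReal.mul_ne_top (by simp) (by simp))
  calc (n : ℝ≥0∞) * (((2 : ℕ) : ℝ≥0∞) * ((2 * (n : ℝ≥0∞))⁻¹ * c))
      = ((2 * (n : ℝ≥0∞)) * (2 * (n : ℝ≥0∞))⁻¹) * c := by push_cast; ring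
    _ = c := by rw [h, one_mul]

lemma step {n : ℕ} (hn : n ≠ 0) (a : Fin n → ℤ) (α β : ℝ) (hα₁ : 1 < α) (hα₂ : α ≤ 2)
    (hβ₁ : 1 / 2 < β) (hβ₂ : β < 1) (j : Fin n) (hj : (a j).natAbs = normInf a)
    (hpos : 0 < normInf a) (t : ℕ) :
    S n a α β j t ≤ S n a α β j (t + 1) +
      (ENNReal.ofReal (Real.log 4) / n) * Q n a α β t := by
  set L := ENNReal.ofReal (Real.log 4) with hL
  have hS : S n a α β j (t + 1) = ∑' s : RlsState n, rlsDist n a α β t s *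
      ∑ i : Fin n, ∑ b : Bool, (1 / (2 * (n : ℝ≥0∞))) * pot a j (rlsUpdate a α β s i b) := by
    unfold S
    simp only [rlsDist]
    simp_rw [← ENNReal.tsum_mul_right]
    rw [ENNReal.tsum_comm]
    refine tsum_congr fun s => ?_
    rw [← trans_sum a α β s (pot a j), ← ENNReal.tsum_mul_left]
    refine tsum_congr fun s' => ?_
    rw [mul_assoc]
  rw [hS]
  unfold S Q
  rw [← ENNReal.tsum_mul_left, ← ENNReal.tsum_add]
  refine ENNReal.tsum_le_tsum fun s => ?_
  by_cases h : fitness a s.1 = 0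
  · rw [pot_opt a j hj hpos s h]; simp
  rw [if_neg h, mul_comm (L / n), ← mul_add]
  refine mul_le_mul_right ?_ _
  have hLs : ∑ i : Fin n, ∑ _b : Bool, (1 / (2 * (n : ℝ≥0∞))) * (if i = j then L else 0)
      = L / n := by
    simp only [Finset.sum_const, Finset.card_univ, Fintype.card_bool, mul_ite, mul_zero,
      nsmul_eq_mul, Finset.sum_ite_eq', Finset.mem_univ, if_true, one_div]
    rw [ENNReal.mul_inv (by simp) (by simp), div_eq_mul_inv]
    have h2 : (2 : ℝ≥0∞) * 2⁻¹ = 1 := ENNReal.mul_inv_cancel (by simp) (by simp)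
    calc ((2 : ℕ) : ℝ≥0∞) * (2⁻¹ * (n : ℝ≥0∞)⁻¹ * L) = (2 * 2⁻¹) * (L * (n : ℝ≥0∞)⁻¹) := by
          push_cast; ring
      _ = _ := by rw [h2, one_mul]
  rw [← hLs, ← Finset.sum_add_distrib]
  simp_rw [← Finset.sum_add_distrib, ← mul_add]
  conv_lhs => rw [← const_sum hn (pot a j s)]
  refine Finset.sum_le_sum fun i _ => Finset.sum_le_sum fun b _ => mul_le_mul_right ?_ _
  exact pot_update a α β hα₁ hα₂ hβ₁ hβ₂ s i j b

lemma S_le {n : ℕ} (a : Fin n → ℤ) (α β : ℝ) (j : Fin n) (hj : (a j).natAbs = normInf a)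
    (hpos : 0 < normInf a) (t : ℕ) :
    S n a α β j t ≤ ENNReal.ofReal (Real.log (normInf a)) * Q n a α β t := by
  unfold S Q
  rw [← ENNReal.tsum_mul_left]
  refine ENNReal.tsum_le_tsum fun s => ?_
  split_ifs with h
  · rw [pot_opt a j hj hpos s h]; simp
  · rw [mul_comm]
    exact mul_le_mul_left (pot_le a j s) _

lemma S_zero {n : ℕ} (a : Fin n → ℤ) (α β : ℝ) (j : Fin n) :
    S n a α β j 0 = ENNReal.ofReal (Real.log (normInf a)) := by
  unfold S
  simp only [rlsDist]
  rw [tsum_eq_single ((fun _ => 0), fun _ => 1)]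
  · simp [pot, size]
  · intro s hs
    simp [hs]

lemma telescoped {n : ℕ} (hn : n ≠ 0) (a : Fin n → ℤ) (α β : ℝ) (hα₁ : 1 < α) (hα₂ : α ≤ 2)
    (hβ₁ : 1 / 2 < β) (hβ₂ : β < 1) (j : Fin n) (hj : (a j).natAbs = normInf a)
    (hpos : 0 < normInf a) (N : ℕ) :
    S n a α β j 0 ≤ S n a α β j N +
      (ENNReal.ofReal (Real.log 4) / n) * ∑ t ∈ Finset.range N, Q n a α β t := by
  induction N with
  | zero => simp
  | succ N ih =>
    refine le_trans ih ?_
    rw [Finset.sum_range_succ, mul_add]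
    have := step hn a α β hα₁ hα₂ hβ₁ hβ₂ j hj hpos N
    refine le_trans (add_le_add_left this _) (le_of_eq ?_)
    ring

end RlsAux

/-- **RLS lower bound via the maximal component.**
For all constants `α` with `1 < α ≤ 2` and `β` with `1/2 < β < 1` and every
`a ∈ ℤⁿ \ {0ⁿ}`, the expected optimization time of `RLS_{α,β}`, started with the all-`0`
integer string and all-`1` velocity vector, on `f_a` is `Ω(n · log |a|_∞)`: the velocity of
any fixed entry at most doubles each time that entry is selected, each entry is selected
with probability `1/n` per iteration, and the entry at distance `|a|_∞` from its target
requires at least `log(|a|_∞) − 1` selections, so additive drift yields expected time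
`Ω(n · log |a|_∞)`. -/
theorem rls_lower_bound_max_component (α β : ℝ) (hα₁ : 1 < α) (hα₂ : α ≤ 2)
    (hβ₁ : 1 / 2 < β) (hβ₂ : β < 1) :
    ∃ c : ℝ, 0 < c ∧ ∀ (n : ℕ) (a : Fin n → ℤ), a ≠ 0 →
      ENNReal.ofReal (c * n * Real.log (normInf a)) ≤ rlsExpTime n a α β := by
  refine ⟨1 / Real.log 4, by positivity, ?_⟩
  intro n a ha
  have hn : n ≠ 0 := by
    rintro rfl
    exact ha (Subsingleton.elim _ _)
  have : NeZero n := ⟨hn⟩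
  obtain ⟨j, -, hj⟩ := Finset.exists_mem_eq_sup (Finset.univ : Finset (Fin n))
    Finset.univ_nonempty (fun i => (a i).natAbs)
  have hj' : (a j).natAbs = normInf a := hj.symm
  have hpos : 0 < normInf a := by
    obtain ⟨i, hi⟩ := Function.ne_iff.mp ha
    have h1 : (a i).natAbs ≤ normInf a :=
      Finset.le_sup (f := fun i => (a i).natAbs) (Finset.mem_univ i)
    exact lt_of_lt_of_le (Int.natAbs_pos.mpr hi) h1
  have hE : rlsExpTime n a α β = ∑' t, RlsAux.Q n a α β t := rfl
  by_cases htop : rlsExpTime n a α β = ⊤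
  · rw [htop]; exact le_top
  have hQ : Filter.Tendsto (RlsAux.Q n a α β) Filter.atTop (nhds 0) :=
    ENNReal.tendsto_atTop_zero_of_tsum_ne_top (hE ▸ htop)
  have hlog4 : 0 < Real.log 4 := Real.log_pos (by norm_num)
  have hbound : ∀ N, ENNReal.ofReal (Real.log (normInf a)) ≤
      ENNReal.ofReal (Real.log (normInf a)) * RlsAux.Q n a α β N +
      (ENNReal.ofReal (Real.log 4) / n) * rlsExpTime n a α β := by
    intro N
    have h := RlsAux.telescoped hn a α β hα₁ hα₂ hβ₁ hβ₂ j hj' hpos N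
    rw [RlsAux.S_zero] at h
    refine h.trans (add_le_add (RlsAux.S_le a α β j hj' hpos N) ?_)
    rw [hE]
    exact mul_le_mul_right (ENNReal.sum_le_tsum _) _
  have hlim : ENNReal.ofReal (Real.log (normInf a)) ≤
      (ENNReal.ofReal (Real.log 4) / n) * rlsExpTime n a α β := by
    have h1 := (ENNReal.Tendsto.const_mul (a := ENNReal.ofReal (Real.log (normInf a))) hQ
      (Or.inr ENNReal.ofReal_ne_top)).add_const
        ((ENNReal.ofReal (Real.log 4) / n) * rlsExpTime n a α β)
    rw [mul_zero, zero_add] at h1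
    exact ge_of_tendsto' h1 hbound
  have hL0 : ENNReal.ofReal (Real.log 4) ≠ 0 := by simpa using hlog4
  have hn0 : (n : ℝ≥0∞) ≠ 0 := by exact_mod_cast hn
  have hnR : (0 : ℝ) < n := by exact_mod_cast Nat.pos_of_ne_zero hn
  have heq : ENNReal.ofReal (1 / Real.log 4 * n * Real.log (normInf a)) =
      ((n : ℝ≥0∞) / ENNReal.ofReal (Real.log 4)) * ENNReal.ofReal (Real.log (normInf a)) := by
    rw [ENNReal.ofReal_mul (by positivity)]
    congr 1
    rw [← ENNReal.ofReal_natCast n, ← ENNReal.ofReal_div_of_pos hlog4]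
    congr 1
    ring
  rw [heq]
  refine (mul_le_mul_right hlim _).trans (le_of_eq ?_)
  rw [← mul_assoc, div_eq_mul_inv, div_eq_mul_inv]
  have e1 := ENNReal.mul_inv_cancel hL0 ENNReal.ofReal_ne_top
  have e2 := ENNReal.mul_inv_cancel hn0 (ENNReal.natCast_ne_top n)
  calc (n : ℝ≥0∞) * (ENNReal.ofReal (Real.log 4))⁻¹ *
        (ENNReal.ofReal (Real.log 4) * (n : ℝ≥0∞)⁻¹) * rlsExpTime n a α β
      = ((n : ℝ≥0∞) * (n : ℝ≥0∞)⁻¹) * (ENNReal.ofReal (Real.log 4) *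
        (ENNReal.ofReal (Real.log 4))⁻¹) * rlsExpTime n a α β := by ring
    _ = rlsExpTime n a α β := by rw [e1, e2, one_mul, one_mul]
end
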